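/- Let G be a finite graph with at least one edge. Over the schema with binary relations E and L, take for each node v of G a variable x_v and a variable y_v, let EDGES = {E(x_u, x_v) | (u,v) an edge of G} and LABELS = {L(x_v, y_v) | v a node of G}, and let Q₁ be the full conjunctive query H(x⃗, y⃗) ← EDGES, LABELS whose head lists all variables x_v and y_v. For each edge (u,v) of G let h_{uv} be the substitution mapping both y_u and y_v to a common fresh variable and fixing all other variables, and let Q^∀h be the union over all edges (u,v) of the queries h_{uv}(head(Q₁)) ← h_{uv}(EDGES ∪ LABELS). Let Q^{>3} be the union, over all choices of four distinct color variables y_{v₁}, y_{v₂}, y_{v₃}, y_{v₄}, of the query head(Q₁) ← EDGES, LABELS, together with the inequalities y_{vᵢ} ≠ y_{vⱼ} for all 1 ≤ i < j ≤ 4. Let Q₂ = Q^∀h ∪ Q^{>3}. Then Q₁ ⊄ Q₂ if and only if G is 3-colorable (i.e., there is an assignment of one of three colors to each node such that adjacent nodes receive distinct colors). -/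

import Mathlib

/-- An atom `R(x₁,…,x_k)`: a relation name together with a tuple of variables. -/
structure Atom (R V : Type) where
  rel : R
  args : List V
deriving DecidableEq

/-- A fact `R(t)`: a relation name together with a tuple of data values. -/
structure DBFact (R D : Type) where
  rel : R
  args : List D
deriving DecidableEq

/-- Applying a valuation to an atom yields a fact. -/
def Atom.app {R V D : Type} (f : V → D) (a : Atom R V) : DBFact R D :=
  ⟨a.rel, a.args.map f⟩

/-- The variables occurring in an atom. -/
def Atom.vars {R V : Type} (a : Atom R V) : Set V := {v | v ∈ a.args}

/-- A conjunctive query with negation and inequalities (CQ¬,≠): a head atom,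
finite sets of positive and negated body atoms, and a finite set of
inequalities between variables. -/
structure CQ (R V : Type) where
  head : Atom R V
  pos : Finset (Atom R V)
  neg : Finset (Atom R V)
  ineq : Finset (V × V)

namespace CQ

variable {R V D : Type}

/-- The variables occurring in a query. -/
def vars (Q : CQ R V) : Set V :=
  Q.head.vars ∪ (⋃ a ∈ (↑Q.pos : Set (Atom R V)), a.vars) ∪
    (⋃ a ∈ (↑Q.neg : Set (Atom R V)), a.vars) ∪
    (⋃ p ∈ (↑Q.ineq : Set (V × V)), {p.1, p.2})

/-- Safety: every head variable and every variable of a negated atom occurs in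
some positive atom. -/
def safe (Q : CQ R V) : Prop :=
  (∀ v ∈ Q.head.vars, ∃ a ∈ Q.pos, v ∈ a.args) ∧
  (∀ a ∈ Q.neg, ∀ v ∈ a.args, ∃ b ∈ Q.pos, v ∈ b.args)

/-- A query is full if every one of its variables occurs in its head atom. -/
def isFull (Q : CQ R V) : Prop := ∀ v ∈ Q.vars, v ∈ Q.head.args

/-- The facts required by a valuation `f`: `f(pos(Q))`. -/
def posFacts (Q : CQ R V) (f : V → D) : Set (DBFact R D) :=
  Atom.app f '' (↑Q.pos : Set (Atom R V))

/-- The facts prohibited by a valuation `f`: `f(neg(Q))`. -/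
def negFacts (Q : CQ R V) (f : V → D) : Set (DBFact R D) :=
  Atom.app f '' (↑Q.neg : Set (Atom R V))

/-- `f` is a valuation for `Q`: required and prohibited facts are disjoint and
all inequalities are respected. -/
def isVal (Q : CQ R V) (f : V → D) : Prop :=
  Q.posFacts f ∩ Q.negFacts f = ∅ ∧
  ∀ p ∈ Q.ineq, f p.1 ≠ f p.2

/-- `f` satisfies `Q` on `I`: all required facts are in `I` and no prohibited
fact is in `I`. -/
def sat (Q : CQ R V) (f : V → D) (I : Set (DBFact R D)) : Prop :=
  Q.posFacts f ⊆ I ∧ Q.negFacts f ∩ I = ∅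

/-- `Q(I)`: the set of facts derived on `I` by valuations satisfying `Q`. -/
def eval (Q : CQ R V) (I : Set (DBFact R D)) : Set (DBFact R D) :=
  {fc | ∃ f : V → D, Q.isVal f ∧ Q.sat f I ∧ Atom.app f Q.head = fc}

end CQ

/-- A union of conjunctive queries (with negation and inequalities): a finite,
nonempty family of CQ¬,≠s. -/
structure UCQ (R V : Type) where
  n : ℕ
  npos : 0 < n
  disj : Fin n → CQ R V

namespace UCQ

variable {R V D : Type}

/-- Well-formedness of a UCQ: every disjunct is safe, all disjuncts have the
same head relation, and distinct disjuncts have disjoint variable sets. -/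
def wf (Q : UCQ R V) : Prop :=
  (∀ i, (Q.disj i).safe) ∧
  (∀ i j, (Q.disj i).head.rel = (Q.disj j).head.rel) ∧
  (∀ i j, i ≠ j → Disjoint (Q.disj i).vars (Q.disj j).vars)

/-- `Q(I) = ⋃ᵢ Qᵢ(I)`. -/
def eval (Q : UCQ R V) (I : Set (DBFact R D)) : Set (DBFact R D) :=
  ⋃ i, (Q.disj i).eval I

/-- The maximum number of variables of any disjunct. -/
noncomputable def varmax (Q : UCQ R V) : ℕ :=
  Finset.univ.sup fun i => ((Q.disj i).vars).ncard

end UCQ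

/-- The values of the fact all belong to `U`. -/
def DBFact.valsIn {R D : Type} (fc : DBFact R D) (U : Set D) : Prop :=
  ∀ d ∈ fc.args, d ∈ U

/-- The active domain of an instance: all data values occurring in it. -/
def adom {R D : Type} (I : Set (DBFact R D)) : Set D :=
  {d | ∃ fc ∈ I, d ∈ fc.args}

/-- Applying a substitution (a map on variables) to an atom. -/
def Atom.subst {R V W : Type} (h : V → W) (a : Atom R V) : Atom R W :=
  ⟨a.rel, a.args.map h⟩

/-- The result of a union of a set of CQs: `⋃ q ∈ S, q(I)`. -/
def evalUnion {R V D : Type} (S : Set (CQ R V)) (I : Set (DBFact R D)) :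
    Set (DBFact R D) :=
  ⋃ q ∈ S, q.eval I

/-- The schema of the reduction: binary relations `E` and `L`, and the head
relation `H`. -/
inductive Rel16 | E | L | H
deriving DecidableEq

/-- Variables: a node variable `x v` and a color variable `y v` for every node
`v`, and a fresh variable `z u v` for every edge `(u,v)`. -/
inductive Var16 (k : ℕ)
  | x (v : Fin k)
  | y (v : Fin k)
  | z (u v : Fin k)
deriving DecidableEq

/-- The list of node variables `x_v` (in the order of the nodes). -/
def xList (k : ℕ) : List (Var16 k) := (List.finRange k).map Var16.x

/-- The list of color variables `y_v` (in the order of the nodes). -/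
def yList (k : ℕ) : List (Var16 k) := (List.finRange k).map Var16.y

/-- `EDGES = {E(x_u, x_v) | (u,v) an edge of G}`. -/
def edgeAtoms {k : ℕ} (G : SimpleGraph (Fin k)) [DecidableRel G.Adj] :
    Finset (Atom Rel16 (Var16 k)) :=
  (Finset.univ.filter (fun p : Fin k × Fin k => G.Adj p.1 p.2)).image
    (fun p => ⟨Rel16.E, [Var16.x p.1, Var16.x p.2]⟩)

/-- `LABELS = {L(x_v, y_v) | v a node of G}`. -/
def labelAtoms (k : ℕ) : Finset (Atom Rel16 (Var16 k)) :=
  Finset.univ.image (fun v : Fin k => ⟨Rel16.L, [Var16.x v, Var16.y v]⟩)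

/-- `Q₁ : H(x⃗, y⃗) ← EDGES, LABELS`. -/
def colQ1 {k : ℕ} (G : SimpleGraph (Fin k)) [DecidableRel G.Adj] :
    CQ Rel16 (Var16 k) :=
  ⟨⟨Rel16.H, xList k ++ yList k⟩, edgeAtoms G ∪ labelAtoms k, ∅, ∅⟩

/-- The collision-revealing substitution `h_{uv}`: it maps `y_u` and `y_v` to
the common fresh variable `z u v` and fixes all other variables. -/
def hsub {k : ℕ} (u v : Fin k) : Var16 k → Var16 k :=
  fun w => if w = Var16.y u ∨ w = Var16.y v then Var16.z u v else w

/-- The disjunct `h_{uv}(head(Q₁)) ← h_{uv}(EDGES ∪ LABELS)` of `Q^∀h`. -/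
def collDisj {k : ℕ} (G : SimpleGraph (Fin k)) [DecidableRel G.Adj]
    (u v : Fin k) : CQ Rel16 (Var16 k) :=
  ⟨Atom.subst (hsub u v) (colQ1 G).head,
   ((colQ1 G).pos).image (Atom.subst (hsub u v)), ∅, ∅⟩

/-- The disjunct of `Q^{>3}` for four distinct color variables
`y_{v₁}, y_{v₂}, y_{v₃}, y_{v₄}`: `head(Q₁) ← EDGES, LABELS` together with the
inequalities `y_{vᵢ} ≠ y_{vⱼ}` for `1 ≤ i < j ≤ 4`. -/
def bigDisj {k : ℕ} (G : SimpleGraph (Fin k)) [DecidableRel G.Adj]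
    (v1 v2 v3 v4 : Fin k) : CQ Rel16 (Var16 k) :=
  ⟨(colQ1 G).head, (colQ1 G).pos, ∅,
   {(Var16.y v1, Var16.y v2), (Var16.y v1, Var16.y v3), (Var16.y v1, Var16.y v4),
    (Var16.y v2, Var16.y v3), (Var16.y v2, Var16.y v4), (Var16.y v3, Var16.y v4)}⟩

/-- `Q₂ = Q^∀h ∪ Q^{>3}` (as the set of its disjuncts). -/
def colQ2 {k : ℕ} (G : SimpleGraph (Fin k)) [DecidableRel G.Adj] :
    Set (CQ Rel16 (Var16 k)) :=
  {q | ∃ u v : Fin k, G.Adj u v ∧ q = collDisj G u v} ∪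
  {q | ∃ v1 v2 v3 v4 : Fin k,
        v1 ≠ v2 ∧ v1 ≠ v3 ∧ v1 ≠ v4 ∧ v2 ≠ v3 ∧ v2 ≠ v4 ∧ v3 ≠ v4 ∧
        q = bigDisj G v1 v2 v3 v4}

lemma app_colQ1_head_eq_iff {k : ℕ} {D : Type} (G : SimpleGraph (Fin k)) [DecidableRel G.Adj]
    (f g : Var16 k → D) :
    Atom.app f (colQ1 G).head = Atom.app g (colQ1 G).head ↔
      ∀ v, f (Var16.x v) = g (Var16.x v) ∧ f (Var16.y v) = g (Var16.y v) := by
  simp [Atom.app, colQ1, xList, yList, -List.map_append, List.map_inj_left, or_imp, forall_and]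

lemma colQ1_posFacts_congr {k : ℕ} {D : Type} (G : SimpleGraph (Fin k)) [DecidableRel G.Adj]
    {f g : Var16 k → D}
    (h : ∀ v, f (Var16.x v) = g (Var16.x v) ∧ f (Var16.y v) = g (Var16.y v)) :
    (colQ1 G).posFacts f = (colQ1 G).posFacts g := by
  refine Set.image_congr fun a ha => ?_
  simp only [colQ1, edgeAtoms, labelAtoms, Finset.coe_union, Finset.coe_image, Set.mem_union,
    Set.mem_image] at ha
  obtain ⟨p, -, rfl⟩ | ⟨v, -, rfl⟩ := ha <;> simp [Atom.app, h]

lemma Atom.app_subst {R V W D : Type} (h : V → W) (g : W → D) (a : Atom R V) :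
    Atom.app g (Atom.subst h a) = Atom.app (g ∘ h) a := by
  simp [Atom.app, Atom.subst]

lemma mem_eval_colQ1_iff {k : ℕ} {D : Type} (G : SimpleGraph (Fin k)) [DecidableRel G.Adj]
    (I : Set (DBFact Rel16 D)) (fc : DBFact Rel16 D) :
    fc ∈ (colQ1 G).eval I ↔
      ∃ f : Var16 k → D, (colQ1 G).posFacts f ⊆ I ∧ Atom.app f (colQ1 G).head = fc := by
  simp [CQ.eval, CQ.isVal, CQ.sat, CQ.negFacts, colQ1]

lemma mem_eval_collDisj_iff {k : ℕ} {D : Type} (G : SimpleGraph (Fin k)) [DecidableRel G.Adj]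
    (u v : Fin k) (I : Set (DBFact Rel16 D)) (fc : DBFact Rel16 D) :
    fc ∈ (collDisj G u v).eval I ↔
      ∃ g : Var16 k → D, (colQ1 G).posFacts (g ∘ hsub u v) ⊆ I ∧
        Atom.app (g ∘ hsub u v) (colQ1 G).head = fc := by
  simp [CQ.eval, CQ.isVal, CQ.sat, CQ.negFacts, CQ.posFacts, collDisj, Set.subset_def,
    Atom.app_subst]

lemma mem_eval_bigDisj_iff {k : ℕ} {D : Type} (G : SimpleGraph (Fin k)) [DecidableRel G.Adj]
    (v1 v2 v3 v4 : Fin k) (I : Set (DBFact Rel16 D)) (fc : DBFact Rel16 D) :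
    fc ∈ (bigDisj G v1 v2 v3 v4).eval I ↔
      ∃ f : Var16 k → D,
        (f (Var16.y v1) ≠ f (Var16.y v2) ∧ f (Var16.y v1) ≠ f (Var16.y v3) ∧
          f (Var16.y v1) ≠ f (Var16.y v4) ∧ f (Var16.y v2) ≠ f (Var16.y v3) ∧
          f (Var16.y v2) ≠ f (Var16.y v4) ∧ f (Var16.y v3) ≠ f (Var16.y v4)) ∧
        (colQ1 G).posFacts f ⊆ I ∧ Atom.app f (colQ1 G).head = fc := by
  simp [CQ.eval, CQ.isVal, CQ.sat, CQ.negFacts, CQ.posFacts, bigDisj]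

/-- A valuation of `Q₁` giving `y u` and `y v` the same value factors through `hsub u v`. -/
lemma exists_comp_hsub_agree {k : ℕ} {D : Type} {u v : Fin k} {f : Var16 k → D}
    (huv : f (Var16.y u) = f (Var16.y v)) :
    ∃ g : Var16 k → D, ∀ w, (g ∘ hsub u v) (Var16.x w) = f (Var16.x w) ∧
      (g ∘ hsub u v) (Var16.y w) = f (Var16.y w) := by
  refine ⟨Function.update f (Var16.z u v) (f (Var16.y u)), fun w => ⟨by simp [hsub], ?_⟩⟩
  by_cases hu : w = u
  · simp [hsub, hu]
  by_cases hv : w = v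
  · simp [hsub, hv, huv]
  · simp [hsub, hu, hv]

/-- A function without four pairwise distinct values has its kernel refined by a map to `Fin 3`. -/
lemma exists_fin_three_of_no_four_values {α β : Type*} [Finite α] (f : α → β)
    (h : ∀ a : Fin 4 → α, ¬ Function.Injective (f ∘ a)) :
    ∃ c : α → Fin 3, ∀ a b, c a = c b → f a = f b := by
  classical
  have := Fintype.ofFinite α
  by_cases hc : Fintype.card (Set.range f) ≤ 3
  · obtain ⟨e⟩ : Nonempty (Set.range f ↪ Fin 3) :=
      Function.Embedding.nonempty_of_card_le (by simpa using hc)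
    exact ⟨fun a => e ⟨f a, a, rfl⟩, fun a b hab => congrArg Subtype.val (e.injective hab)⟩
  · obtain ⟨e⟩ : Nonempty (Fin 4 ↪ Set.range f) :=
      Function.Embedding.nonempty_of_card_le (by rw [Fintype.card_fin]; omega)
    choose a ha using fun i => (e i).2
    refine (h a fun i j hij => e.injective (Subtype.ext ?_)).elim
    rw [← ha i, ← ha j]
    exact hij

/-- For a finite graph `G` with at least one edge,
`Q₁ ⊄ Q₂` iff `G` is 3-colorable. -/
theorem colorability_reduction (k : ℕ) (G : SimpleGraph (Fin k))
    [DecidableRel G.Adj] (hedge : ∃ u v, G.Adj u v) :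
    (¬ ∀ I : Set (DBFact Rel16 ℕ), I.Finite →
        (colQ1 G).eval I ⊆ evalUnion (colQ2 G) I) ↔
      ∃ c : Fin k → Fin 3, ∀ u v, G.Adj u v → c u ≠ c v := by
  constructor
  · intro h
    push Not at h
    obtain ⟨I, -, hI⟩ := h
    obtain ⟨fc, h1, h2⟩ := Set.not_subset.1 hI
    obtain ⟨f, hfI, rfl⟩ := (mem_eval_colQ1_iff G I fc).1 h1
    have hmem : ∀ q ∈ colQ2 G, Atom.app f (colQ1 G).head ∉ q.eval I :=
      fun q hq hf => h2 (Set.mem_biUnion hq hf)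
    obtain ⟨c, hc⟩ := exists_fin_three_of_no_four_values (fun v => f (Var16.y v)) fun a ha => by
      have hne : ∀ i j, i ≠ j → f (Var16.y (a i)) ≠ f (Var16.y (a j)) :=
        fun i j hij => ha.ne hij
      have hne' : ∀ i j, i ≠ j → a i ≠ a j := fun i j hij => ha.of_comp.ne hij
      refine hmem (bigDisj G (a 0) (a 1) (a 2) (a 3)) (Or.inr ⟨a 0, a 1, a 2, a 3, ?_⟩) ?_
      · simp [hne']
      · exact (mem_eval_bigDisj_iff G _ _ _ _ I _).2 ⟨f, by simp [hne], hfI, rfl⟩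
    refine ⟨c, fun u v huv hcuv => ?_⟩
    obtain ⟨g, hg⟩ := exists_comp_hsub_agree (hc u v hcuv)
    refine hmem (collDisj G u v) (Or.inl ⟨u, v, huv, rfl⟩) ?_
    exact (mem_eval_collDisj_iff G u v I _).2
      ⟨g, (colQ1_posFacts_congr G hg).trans_subset hfI, (app_colQ1_head_eq_iff G _ _).2 hg⟩
  · rintro ⟨c, hc⟩ h
    let f : Var16 k → ℕ
      | .x v => v
      | .y v => c v
      | .z _ _ => 0
    have hf := h ((colQ1 G).posFacts f) ((Finset.finite_toSet _).image _)
      ((mem_eval_colQ1_iff G _ _).2 ⟨f, subset_rfl, rfl⟩)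
    obtain ⟨q, hq, hfq⟩ := Set.mem_iUnion₂.1 hf
    rcases hq with ⟨u, v, huv, rfl⟩ | ⟨v1, v2, v3, v4, -, -, -, -, -, -, rfl⟩
    · obtain ⟨g, -, hg⟩ := (mem_eval_collDisj_iff G u v _ _).1 hfq
      rw [app_colQ1_head_eq_iff] at hg
      have hu := (hg u).2
      have hv := (hg v).2
      simp only [Function.comp_apply, hsub, true_or, or_true, if_true, f] at hu hv
      exact hc u v huv (Fin.ext (hu.symm.trans hv))
    · obtain ⟨g, hne, -, hg⟩ := (mem_eval_bigDisj_iff G _ _ _ _ _ _).1 hfq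
      rw [app_colQ1_head_eq_iff] at hg
      simp only [(hg _).2, f] at hne
      omega
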